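/- Let B₃ denote the 8-element Boolean lattice of all subsets of a three-element set. There is no finite lattice L such that Con L is order-isomorphic to B₃ via an isomorphism mapping Princ L onto J⁺(B₃); that is, Q = J⁺(B₃) is not principal congruence representable in B₃. -/

import Mathlib

/-- A congruence of a lattice: an equivalence relation compatible with `⊔` and `⊓`. -/
structure LatCon (L : Type*) [Lattice L] where
  r : L → L → Prop
  refl : ∀ a, r a a
  symm : ∀ {a b}, r a b → r b a
  trans : ∀ {a b c}, r a b → r b c → r a c
  sup_comp : ∀ {a b c d}, r a b → r c d → r (a ⊔ c) (b ⊔ d)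
  inf_comp : ∀ {a b c d}, r a b → r c d → r (a ⊓ c) (b ⊓ d)

namespace LatCon

variable {L : Type*} [Lattice L]

theorem ext' {θ ψ : LatCon L} (h : ∀ a b, θ.r a b ↔ ψ.r a b) : θ = ψ := by
  cases θ; cases ψ
  simp only [mk.injEq]
  funext a b
  exact propext (h a b)

/-- Congruences are ordered by containment. -/
instance : PartialOrder (LatCon L) where
  le θ ψ := ∀ a b, θ.r a b → ψ.r a b
  le_refl θ := fun _ _ h => h
  le_trans θ ψ χ h1 h2 := fun a b h => h2 a b (h1 a b h)
  le_antisymm θ ψ h1 h2 := ext' fun a b => ⟨h1 a b, h2 a b⟩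

instance : InfSet (LatCon L) where
  sInf S :=
    { r := fun a b => ∀ θ ∈ S, θ.r a b
      refl := fun a θ _ => θ.refl a
      symm := fun h θ hθ => θ.symm (h θ hθ)
      trans := fun h1 h2 θ hθ => θ.trans (h1 θ hθ) (h2 θ hθ)
      sup_comp := fun h1 h2 θ hθ => θ.sup_comp (h1 θ hθ) (h2 θ hθ)
      inf_comp := fun h1 h2 θ hθ => θ.inf_comp (h1 θ hθ) (h2 θ hθ) }

/-- `Con L`, the lattice of congruences of `L`, is a complete lattice. -/
instance : CompleteLattice (LatCon L) :=
  completeLatticeOfInf (LatCon L) fun S =>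
    ⟨fun θ hθ a b h => h θ hθ, fun ψ hψ a b h θ hθ => hψ hθ a b h⟩

/-- The principal congruence `con(a, b)`: the smallest congruence collapsing `a` and `b`. -/
def princ (a b : L) : LatCon L := sInf {θ : LatCon L | θ.r a b}

/-- A congruence is principal if it is of the form `con(a, b)`. -/
def IsPrincipal (θ : LatCon L) : Prop := ∃ a b : L, θ = princ a b

end LatCon

/-- `Princ L`, the set of principal congruences of a lattice `L`,
ordered by containment (the order inherited from `Con L`). -/
def Princ (L : Type*) [Lattice L] : Set (LatCon L) := {θ : LatCon L | θ.IsPrincipal}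

/-- `J⁺(D) = {⊥, ⊤} ∪ J(D)`, where `J(D)` is the set of join-irreducible elements. -/
def Jplus (D : Type*) [Lattice D] [BoundedOrder D] : Set D :=
  {⊥, ⊤} ∪ {x : D | SupIrred x}

/-- `Q ⊆ D` is principal congruence representable: there are a finite lattice `L` and
an order isomorphism `φ : Con L ≃o D` mapping `Princ L` exactly onto `Q`. -/
def Representable (D : Type*) [Lattice D] (Q : Set D) : Prop :=
  ∃ (L : Type) (_ : Lattice L) (_ : Fintype L) (φ : LatCon L ≃o D),
    φ '' Princ L = Q

/-- `D` is fully representable: every candidate `J⁺(D) ⊆ Q ⊆ D` is representable. -/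
def FullyRepresentable (D : Type*) [Lattice D] [BoundedOrder D] : Prop :=
  ∀ Q : Set D, Jplus D ⊆ Q → Representable D Q

universe u


namespace LatCon

variable {L : Type*} [Lattice L]

theorem princ_r (a b : L) : (princ a b).r a b := fun _ hθ => hθ

theorem princ_le_iff {a b : L} {θ : LatCon L} : princ a b ≤ θ ↔ θ.r a b :=
  ⟨fun h => h a b (princ_r a b), fun h _ _ hxy => hxy θ h⟩

theorem r_of_inf_sup {θ : LatCon L} {a b : L} (h : θ.r (a ⊓ b) (a ⊔ b)) : θ.r a b := by
  have ha : θ.r a (a ⊔ b) := by simpa using θ.sup_comp (θ.refl a) h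
  have hb : θ.r b (a ⊔ b) := by simpa using θ.sup_comp (θ.refl b) h
  exact θ.trans ha (θ.symm hb)

theorem princ_le_princ_sup_princ (a b c : L) : princ a c ≤ princ a b ⊔ princ b c :=
  princ_le_iff.2 <| (princ a b ⊔ princ b c).trans
    (princ_le_iff.1 le_sup_left) (princ_le_iff.1 le_sup_right)

/-- A self-map of `L` preserving every congruence, such as a unary polynomial. -/
def Compatible (f : L → L) : Prop := ∀ (θ : LatCon L) (x y : L), θ.r x y → θ.r (f x) (f y)

/-- The congruence identifying `x` and `y` when no compatible map with values in `{a, b}`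
separates them. If `b` covers `a`, it is the largest congruence not collapsing `a` and `b`. -/
def separator (a b : L) : LatCon L where
  r x y := ∀ f : L → L, Compatible f → (∀ z, f z = a ∨ f z = b) → f x = f y
  refl _ _ _ _ := rfl
  symm h f hf hz := (h f hf hz).symm
  trans h₁ h₂ f hf hz := (h₁ f hf hz).trans (h₂ f hf hz)
  sup_comp {_ y u _} h₁ h₂ f hf hz :=
    (h₁ (fun t => f (t ⊔ u)) (fun θ _ _ h => hf θ _ _ (θ.sup_comp h (θ.refl u)))
      fun _ => hz _).trans
    (h₂ (fun t => f (y ⊔ t)) (fun θ _ _ h => hf θ _ _ (θ.sup_comp (θ.refl y) h))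
      fun _ => hz _)
  inf_comp {_ y u _} h₁ h₂ f hf hz :=
    (h₁ (fun t => f (t ⊓ u)) (fun θ _ _ h => hf θ _ _ (θ.inf_comp h (θ.refl u)))
      fun _ => hz _).trans
    (h₂ (fun t => f (y ⊓ t)) (fun θ _ _ h => hf θ _ _ (θ.inf_comp (θ.refl y) h))
      fun _ => hz _)

theorem le_separator {a b : L} {θ : LatCon L} (h : ¬ θ.r a b) : θ ≤ separator a b := by
  intro x y hxy f hf hz
  have hr := hf θ x y hxy
  rcases hz x with hx | hx <;> rcases hz y with hy | hy <;> rw [hx, hy] at hr ⊢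
  · exact (h hr).elim
  · exact (h (θ.symm hr)).elim

theorem not_separator_r {a b : L} (h : a ⋖ b) : ¬ (separator a b).r a b := by
  intro hr
  have := hr (fun t => (t ⊔ a) ⊓ b)
    (fun θ _ _ hxy => θ.inf_comp (θ.sup_comp hxy (θ.refl a)) (θ.refl b))
    (fun z => h.eq_or_eq (le_inf le_sup_right h.le) inf_le_right)
  simp [h.le] at this
  exact h.ne this

/-- A cover does not generate the join of congruences which do not collapse it. -/
theorem princ_ne_sSup {a b : L} (h : a ⋖ b) {S : Set (LatCon L)}
    (hS : ∀ θ ∈ S, ¬ princ a b ≤ θ) : princ a b ≠ sSup S := by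
  intro hab
  refine not_separator_r h (princ_le_iff.1 (hab.trans_le ?_))
  exact sSup_le fun θ hθ => le_separator fun hr => hS θ hθ (princ_le_iff.2 hr)

end LatCon

theorem exists_subset_singleton_of_mem_Jplus {x : Set (Fin 3)}
    (hx : x ∈ Jplus (Set (Fin 3))) (hne : x ≠ ⊤) : ∃ i, x ⊆ {i} := by
  rcases hx with (rfl | rfl) | hx
  · exact ⟨0, Set.empty_subset _⟩
  · exact (hne rfl).elim
  · obtain ⟨i, hi⟩ := Set.nonempty_iff_ne_empty.2 hx.ne_bot
    refine ⟨i, ?_⟩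
    rcases hx.2 (show {i} ⊔ x \ {i} = x from
      Set.union_sdiff_cancel (Set.singleton_subset_iff.2 hi)) with h | h
    · exact h.ge
    · rw [← h] at hi
      exact (hi.2 rfl).elim

/-- **Lemma 10.** There is no finite lattice `L` with `Con L ≅ B₃` under an isomorphism
mapping `Princ L` onto `J⁺(B₃)`: the candidate `Q = J⁺(B₃)` is not representable in the
eight-element Boolean lattice `B₃ = Set (Fin 3)`. -/
theorem Jplus_B3_not_representable :
    ¬ Representable (Set (Fin 3)) (Jplus (Set (Fin 3))) := by
  rintro ⟨L, _, _, φ, hφ⟩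
  have mem (a b : L) : φ (LatCon.princ a b) ∈ Jplus (Set (Fin 3)) :=
    hφ ▸ Set.mem_image_of_mem φ ⟨a, b, rfl⟩
  have cover {a b : L} (hab : a ⋖ b) : φ (LatCon.princ a b) ≠ ⊤ := by
    intro htop
    have hab_top : LatCon.princ a b = ⊤ := (map_eq_top_iff φ).1 htop
    refine LatCon.princ_ne_sSup hab (S := Set.range fun i => φ.symm {i}) ?_ ?_
    · rintro _ ⟨i, rfl⟩ hle
      rw [← φ.le_iff_le, htop, φ.apply_symm_apply] at hle
      have h₁ : i + 1 = i := hle (Set.mem_univ (i + 1))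
      simp at h₁
    · rw [hab_top, eq_comm, eq_top_iff, ← φ.le_iff_le, map_top]
      intro i _
      have hi : φ.symm {i} ≤ sSup (Set.range fun i => φ.symm {i}) := le_sSup ⟨i, rfl⟩
      rw [φ.symm_apply_le] at hi
      exact hi rfl
  obtain ⟨a, b₀, hle, htop₀⟩ : ∃ a b : L, a ≤ b ∧ φ (LatCon.princ a b) = ⊤ := by
    obtain ⟨_, ⟨a, b, rfl⟩, hab⟩ : (⊤ : Set (Fin 3)) ∈ φ '' Princ L := by
      rw [hφ]
      exact Or.inl (Or.inr rfl)
    refine ⟨a ⊓ b, a ⊔ b, inf_le_sup, top_le_iff.1 (hab.ge.trans (φ.monotone ?_))⟩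
    exact LatCon.princ_le_iff.2 (LatCon.r_of_inf_sup (LatCon.princ_r _ _))
  obtain ⟨b, ⟨hab, htop⟩, hmin⟩ := wellFounded_lt.has_min
    {b : L | a ≤ b ∧ φ (LatCon.princ a b) = ⊤} ⟨b₀, hle, htop₀⟩
  have hlt : a < b := by
    refine hab.lt_of_ne ?_
    rintro rfl
    have hbot : LatCon.princ a a = ⊥ := le_bot_iff.1 (LatCon.princ_le_iff.2 (LatCon.refl _ a))
    rw [hbot, map_bot] at htop
    exact bot_ne_top htop
  obtain ⟨c, hac, hcb⟩ := exists_le_covBy_of_lt hlt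
  obtain ⟨i, hi⟩ := exists_subset_singleton_of_mem_Jplus (mem a c)
    fun h => hmin c ⟨hac, h⟩ hcb.lt
  obtain ⟨j, hj⟩ := exists_subset_singleton_of_mem_Jplus (mem c b) (cover hcb)
  have hsub := φ.monotone (LatCon.princ_le_princ_sup_princ a c b)
  rw [htop, map_sup] at hsub
  obtain ⟨k, hki, hkj⟩ : ∃ k : Fin 3, k ≠ i ∧ k ≠ j :=
    (by decide : ∀ i j : Fin 3, ∃ k, k ≠ i ∧ k ≠ j) i j
  rcases hsub (Set.mem_univ k) with h | h
  · exact hki (hi h)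
  · exact hkj (hj h)
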